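/- Let t ≥ 3 be an integer and let G = K^c_{n,n} be an edge-colored complete balanced bipartite graph with δ^c(G) ≥ 2n/3 + t that contains no properly colored 2^(t)-factor. Let H be a 1^(t)-path-cycle of G with unique path component P chosen so that |V(H)| is as large as possible and, subject to that, |V(P)| is as large as possible, and write P = u_1 u_2 … u_k with k ≥ 2. Then every neighbor u of u_1 with c(u_1 u) ≠ c(u_1 u_2) lies in V(P), and every neighbor u of u_k with c(u_k u) ≠ c(u_{k-1} u_k) lies in V(P); consequently k ≥ 2δ^c(G). -/

import Mathlib

open SimpleGraph

/-- Vertex type of `K_{n,n}`: left part `X`, right part `Y`. -/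
abbrev V2 (n : ℕ) := Fin n ⊕ Fin n

/-- The complete balanced bipartite graph `K_{n,n}`. -/
def KBB (n : ℕ) : SimpleGraph (V2 n) := completeBipartiteGraph (Fin n) (Fin n)

/-- The color degree of a vertex: the number of distinct colors on its incident edges. -/
def colorDeg (n : ℕ) (c : V2 n → V2 n → ℕ) : V2 n → ℕ
  | Sum.inl x => ((Finset.univ : Finset (Fin n)).image fun j => c (Sum.inl x) (Sum.inr j)).card
  | Sum.inr y => ((Finset.univ : Finset (Fin n)).image fun i => c (Sum.inr y) (Sum.inl i)).card

/-- The minimum color degree `δ^c`. -/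
noncomputable def minColorDeg (n : ℕ) (c : V2 n → V2 n → ℕ) : ℕ :=
  ⨅ v : V2 n, colorDeg n c v

/-- `Δ_mon(v)`: the maximum number of same-colored edges incident to `v`. -/
def monDeg (n : ℕ) (c : V2 n → V2 n → ℕ) : V2 n → ℕ
  | Sum.inl x => Finset.univ.sup fun j : Fin n =>
      (Finset.univ.filter fun j' : Fin n =>
        c (Sum.inl x) (Sum.inr j') = c (Sum.inl x) (Sum.inr j)).card
  | Sum.inr y => Finset.univ.sup fun i : Fin n =>
      (Finset.univ.filter fun i' : Fin n =>
        c (Sum.inr y) (Sum.inl i') = c (Sum.inr y) (Sum.inl i)).card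

/-- A subgraph is properly colored: adjacent edges receive distinct colors. -/
def IsPCSubgraph (n : ℕ) (c : V2 n → V2 n → ℕ) (H : SimpleGraph (V2 n)) : Prop :=
  ∀ u v w, H.Adj u v → H.Adj u w → v ≠ w → c u v ≠ c u w

/-- Every cycle of `H` has length at least `t`. -/
def CyclesAtLeast {n : ℕ} (H : SimpleGraph (V2 n)) (t : ℕ) : Prop :=
  ∀ (v : V2 n) (p : H.Walk v v), p.IsCycle → t ≤ p.length

/-- A properly colored 2-factor of `K_{n,n}`: a spanning 2-regular properly colored
subgraph. -/
def IsPC2Factor (n : ℕ) (c : V2 n → V2 n → ℕ) (H : SimpleGraph (V2 n)) : Prop :=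
  H ≤ KBB n ∧ (∀ v, (H.neighborSet v).ncard = 2) ∧ IsPCSubgraph n c H

/-- A properly colored `2^{(t)}`-factor of the induced subgraph on `S`. -/
def IsPC2FactorOn (n : ℕ) (c : V2 n → V2 n → ℕ) (S : Set (V2 n))
    (H : SimpleGraph (V2 n)) (t : ℕ) : Prop :=
  H ≤ KBB n ∧ (∀ u v, H.Adj u v → u ∈ S) ∧ (∀ v ∈ S, (H.neighborSet v).ncard = 2) ∧
    IsPCSubgraph n c H ∧ CyclesAtLeast H t

/-- A properly colored cycle of length `k` in `K_{n,n}`, given as an injective cyclic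
sequence of vertices with adjacent edges having distinct colors. -/
def IsPCCycle (n : ℕ) (c : V2 n → V2 n → ℕ) (k : ℕ) (f : ZMod k → V2 n) : Prop :=
  Function.Injective f ∧ (∀ i, (KBB n).Adj (f i) (f (i + 1))) ∧
    ∀ i, c (f i) (f (i + 1)) ≠ c (f (i + 1)) (f (i + 2))

/-- Consecutive edges of the vertex list receive distinct colors. -/
def PCL (n : ℕ) (c : V2 n → V2 n → ℕ) : List (V2 n) → Prop
  | a :: b :: d :: rest => c a b ≠ c b d ∧ PCL n c (b :: d :: rest)
  | _ => True

/-- A properly colored path in `K_{n,n}` given by its list of vertices. -/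
def IsPCPath (n : ℕ) (c : V2 n → V2 n → ℕ) (l : List (V2 n)) : Prop :=
  l ≠ [] ∧ l.Nodup ∧ l.Chain' (KBB n).Adj ∧ PCL n c l

/-- A properly colored odd path: odd number of edges, i.e. an even number of vertices,
equivalently one endpoint in each part. -/
def IsPCOddPath (n : ℕ) (c : V2 n → V2 n → ℕ) (l : List (V2 n)) : Prop :=
  IsPCPath n c l ∧ Even l.length

/-- A properly colored 3-path `x' y' x'' y''` with `x', x'' ∈ X` and `y', y'' ∈ Y`,
encoded as the quadruple `(x', y', x'', y'')`. -/
def IsPC3Path (n : ℕ) (c : V2 n → V2 n → ℕ) : Fin n × Fin n × Fin n × Fin n → Prop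
  | (a, b, a', b') =>
    a ≠ a' ∧ b ≠ b' ∧
      c (Sum.inl a) (Sum.inr b) ≠ c (Sum.inr b) (Sum.inl a') ∧
      c (Sum.inr b) (Sum.inl a') ≠ c (Sum.inl a') (Sum.inr b')

/-- An absorbing path `x' y' x'' y''` for the pair `(x, y)`: a PC 3-path avoiding
`{x, y}` such that `x' y' x y x'' y''` is a properly colored path. -/
def IsAbsorbingPath1 (n : ℕ) (c : V2 n → V2 n → ℕ) (x y : Fin n) :
    Fin n × Fin n × Fin n × Fin n → Prop
  | (a, b, a', b') =>
    IsPC3Path n c (a, b, a', b') ∧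
      a ≠ x ∧ a' ≠ x ∧ b ≠ y ∧ b' ≠ y ∧
      c (Sum.inl a) (Sum.inr b) ≠ c (Sum.inr b) (Sum.inl x) ∧
      c (Sum.inr b) (Sum.inl x) ≠ c (Sum.inl x) (Sum.inr y) ∧
      c (Sum.inl x) (Sum.inr y) ≠ c (Sum.inr y) (Sum.inl a') ∧
      c (Sum.inr y) (Sum.inl a') ≠ c (Sum.inl a') (Sum.inr b')

/-- An absorbing path `x' y' x'' y''` for the quadruple `(x₁, y₁; x₂, y₂)`: a PC 3-path
avoiding `{x₁, y₁, x₂, y₂}` such that the paths `x' y' x₁ y₁` and `y'' x'' y₂ x₂`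
are properly colored. -/
def IsAbsorbingPath2 (n : ℕ) (c : V2 n → V2 n → ℕ) (x₁ y₁ x₂ y₂ : Fin n) :
    Fin n × Fin n × Fin n × Fin n → Prop
  | (a, b, a', b') =>
    IsPC3Path n c (a, b, a', b') ∧
      a ≠ x₁ ∧ a ≠ x₂ ∧ a' ≠ x₁ ∧ a' ≠ x₂ ∧ b ≠ y₁ ∧ b ≠ y₂ ∧ b' ≠ y₁ ∧ b' ≠ y₂ ∧
      c (Sum.inl a) (Sum.inr b) ≠ c (Sum.inr b) (Sum.inl x₁) ∧
      c (Sum.inr b) (Sum.inl x₁) ≠ c (Sum.inl x₁) (Sum.inr y₁) ∧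
      c (Sum.inr b') (Sum.inl a') ≠ c (Sum.inl a') (Sum.inr y₂) ∧
      c (Sum.inl a') (Sum.inr y₂) ≠ c (Sum.inr y₂) (Sum.inl x₂)

/-- Two 3-paths (as quadruples) are vertex-disjoint. -/
def QuadDisjoint {n : ℕ} (P Q : Fin n × Fin n × Fin n × Fin n) : Prop :=
  P.1 ≠ Q.1 ∧ P.1 ≠ Q.2.2.1 ∧ P.2.2.1 ≠ Q.1 ∧ P.2.2.1 ≠ Q.2.2.1 ∧
    P.2.1 ≠ Q.2.1 ∧ P.2.1 ≠ Q.2.2.2 ∧ P.2.2.2 ≠ Q.2.1 ∧ P.2.2.2 ≠ Q.2.2.2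

/-- A `1^{(t)}`-path-cycle: a vertex-disjoint union of exactly one PC path and a
(possibly empty) collection of PC cycles, each cycle of length at least `t`. -/
structure OnePathCycleT (n : ℕ) (c : V2 n → V2 n → ℕ) (t : ℕ) where
  path : List (V2 n)
  path_pc : IsPCPath n c path
  numCycles : ℕ
  cycLen : Fin numCycles → ℕ
  cyc : (i : Fin numCycles) → ZMod (cycLen i) → V2 n
  cyc_pc : ∀ i, IsPCCycle n c (cycLen i) (cyc i)
  cyc_long : ∀ i, t ≤ cycLen i
  disj_path_cyc : ∀ i j, cyc i j ∉ path
  disj_cyc_cyc : ∀ i i', i ≠ i' → ∀ j j', cyc i j ≠ cyc i' j'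

/-- The vertex set of a `1^{(t)}`-path-cycle. -/
def OnePathCycleT.verts {n : ℕ} {c : V2 n → V2 n → ℕ} {t : ℕ}
    (H : OnePathCycleT n c t) : Set (V2 n) :=
  {v | v ∈ H.path} ∪ ⋃ i, Set.range (H.cyc i)

section

variable {n : ℕ} {c : V2 n → V2 n → ℕ} {t : ℕ}

theorem KBB_adj_iff {u v : V2 n} : (KBB n).Adj u v ↔ v.isLeft = !u.isLeft := by
  cases u <;> cases v <;> simp [KBB]

theorem PCL_iff_getElem {l : List (V2 n)} :
    PCL n c l ↔ ∀ i, ∀ h : i + 2 < l.length, c l[i] l[i + 1] ≠ c l[i + 1] l[i + 2] := by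
  match l with
  | [] => simp [PCL]
  | [a] => simp [PCL]
  | [a, b] => simp [PCL]
  | a :: b :: d :: r =>
    rw [PCL, PCL_iff_getElem (l := b :: d :: r)]
    constructor
    · rintro ⟨h0, h⟩ (_ | i) hi
      · exact h0
      · exact h i (by simpa using hi)
    · intro h
      exact ⟨h 0 (by simp), fun i hi => h (i + 1) (by simpa using hi)⟩

theorem PCL.reverse (hsym : ∀ u v, c u v = c v u) {l : List (V2 n)} (h : PCL n c l) :
    PCL n c l.reverse := by
  rw [PCL_iff_getElem] at h ⊢
  intro i hi
  rw [List.length_reverse] at hi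
  simp only [List.getElem_reverse]
  have := h (l.length - 1 - (i + 2)) (by omega)
  simp only [show l.length - 1 - (i + 2) + 1 = l.length - 1 - (i + 1) by omega,
    show l.length - 1 - (i + 2) + 2 = l.length - 1 - i by omega] at this
  exact fun e => this (((hsym _ _).trans e.symm).trans (hsym _ _))

theorem PCL.append_overlap {l r : List (V2 n)} {x y : V2 n} (hl : PCL n c (l ++ [x, y]))
    (hr : PCL n c (x :: y :: r)) : PCL n c (l ++ x :: y :: r) := by
  match l with
  | [] => exact hr
  | [a] => exact ⟨hl.1, hr⟩
  | a :: b :: s =>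
    have ih := PCL.append_overlap (l := b :: s) (r := r) (x := x) (y := y)
    cases s with
    | nil => exact ⟨hl.1, ih hl.2 hr⟩
    | cons d s => exact ⟨hl.1, ih hl.2 hr⟩

theorem IsPCPath.reverse (hsym : ∀ u v, c u v = c v u) {l : List (V2 n)}
    (h : IsPCPath n c l) : IsPCPath n c l.reverse := by
  obtain ⟨h1, h2, h3, h4⟩ := h
  refine ⟨by simpa using h1, List.nodup_reverse.2 h2, ?_, h4.reverse hsym⟩
  refine List.isChain_reverse.2 (List.IsChain.imp (fun a b hab => ?_) h3)
  exact hab.symm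

theorem IsPCPath.append {l r : List (V2 n)} {x u a b : V2 n}
    (hl : IsPCPath n c (l ++ [x, u])) (hr : IsPCPath n c (a :: b :: r))
    (hdisj : ∀ v ∈ l ++ [x, u], v ∉ a :: b :: r) (hadj : (KBB n).Adj u a)
    (hx : c x u ≠ c u a) (hb : c u a ≠ c a b) :
    IsPCPath n c (l ++ [x, u] ++ a :: b :: r) := by
  obtain ⟨-, hl2, hl3, hl4⟩ := hl
  obtain ⟨-, hr2, hr3, hr4⟩ := hr
  refine ⟨by simp, List.nodup_append.2 ⟨hl2, hr2, ?_⟩, ?_, ?_⟩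
  · rintro v hv _ hw rfl
    exact hdisj v hv hw
  · refine List.isChain_append.2 ⟨hl3, hr3, ?_⟩
    intro v hv w hw
    simp at hv hw
    subst hv hw
    exact hadj
  · simpa using hl4.append_overlap (r := a :: b :: r) ⟨hx, hb, hr4⟩

theorem IsPCPath.cons {r : List (V2 n)} {u a b : V2 n} (hr : IsPCPath n c (a :: b :: r))
    (hu : u ∉ a :: b :: r) (hadj : (KBB n).Adj u a) (hb : c u a ≠ c a b) :
    IsPCPath n c (u :: a :: b :: r) :=
  ⟨by simp, List.nodup_cons.2 ⟨hu, hr.2.1⟩, List.isChain_cons_cons.2 ⟨hadj, hr.2.2.1⟩,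
    hb, hr.2.2.2⟩

theorem IsPCCycle.neg (hsym : ∀ u v, c u v = c v u) {k : ℕ} {f : ZMod k → V2 n}
    (h : IsPCCycle n c k f) : IsPCCycle n c k fun i => f (-i) := by
  obtain ⟨h1, h2, h3⟩ := h
  refine ⟨h1.comp neg_injective, fun i => ?_, fun i => ?_⟩
  · have := h2 (-(i + 1))
    rw [show -(i + 1) + 1 = -i by ring] at this
    exact this.symm
  · have := h3 (-(i + 2))
    rw [show -(i + 2) + 1 = -(i + 1) by ring, show -(i + 2) + 2 = -i by ring] at this
    exact fun e => this (((hsym _ _).trans e.symm).trans (hsym _ _))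

/-- Deleting the edge that leaves `f j` turns a PC cycle into a PC path ending at `f j`. -/
theorem IsPCCycle.exists_path {k : ℕ} (hk : 2 ≤ k) {f : ZMod k → V2 n}
    (h : IsPCCycle n c k f) (j : ZMod k) :
    ∃ l, IsPCPath n c (l ++ [f (j - 1), f j]) ∧
      ∀ v, v ∈ l ++ [f (j - 1), f j] ↔ v ∈ Set.range f := by
  obtain ⟨m, rfl⟩ : ∃ m, k = m + 2 := ⟨k - 2, by omega⟩
  obtain ⟨h1, h2, h3⟩ := h
  have hcast : (m : ZMod (m + 2)) + 2 = 0 := by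
    have := ZMod.natCast_self (m + 2)
    push_cast at this
    exact this
  have hL : List.ofFn (fun i : Fin (m + 2) => f (j + 1 + (i : ℕ))) =
      List.ofFn (fun i : Fin m => f (j + 1 + (i : ℕ))) ++ [f (j - 1), f j] := by
    rw [List.ofFn_succ_last, List.ofFn_succ_last]
    have e1 : j + 1 + (m : ZMod (m + 2)) = j - 1 := by linear_combination hcast
    have e2 : j + 1 + ((m : ZMod (m + 2)) + 1) = j := by linear_combination hcast
    simp [e1, e2]
  refine ⟨List.ofFn (fun i : Fin m => f (j + 1 + (i : ℕ))), ?_⟩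
  rw [← hL]
  refine ⟨⟨by simp, ?_, ?_, ?_⟩, fun v => ?_⟩
  · refine List.nodup_ofFn.2 fun a b hab => ?_
    have := add_left_cancel (h1 hab)
    rw [ZMod.natCast_eq_natCast_iff', Nat.mod_eq_of_lt a.2, Nat.mod_eq_of_lt b.2] at this
    exact Fin.ext this
  · refine List.isChain_iff_getElem.2 fun i hi => ?_
    have := h2 (j + 1 + i)
    simpa only [List.getElem_ofFn, Nat.cast_add, Nat.cast_one, add_assoc] using this
  · refine PCL_iff_getElem.2 fun i hi => ?_
    have := h3 (j + 1 + i)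
    simpa only [List.getElem_ofFn, Nat.cast_add, Nat.cast_one, Nat.cast_ofNat,
      add_assoc] using this
  · rw [List.mem_ofFn']
    constructor
    · rintro ⟨i, rfl⟩
      exact ⟨_, rfl⟩
    · rintro ⟨i, rfl⟩
      refine ⟨⟨(i - (j + 1)).val, ZMod.val_lt _⟩, ?_⟩
      simp

namespace OnePathCycleT

/-- Replace the path by another PC path that avoids all cycles. -/
def withPath (H : OnePathCycleT n c t) (l : List (V2 n)) (hl : IsPCPath n c l)
    (hd : ∀ i j, H.cyc i j ∉ l) : OnePathCycleT n c t :=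
  { H with path := l, path_pc := hl, disj_path_cyc := hd }

/-- Drop the cycle `i` and replace the path by a PC path that avoids the other cycles. -/
noncomputable def withPathErase (H : OnePathCycleT n c t) (i : Fin H.numCycles)
    (l : List (V2 n)) (hl : IsPCPath n c l) (hd : ∀ i', i' ≠ i → ∀ j, H.cyc i' j ∉ l) :
    OnePathCycleT n c t :=
  let e := (Fintype.equivFin {i' : Fin H.numCycles // i' ≠ i}).symm
  { path := l
    path_pc := hl
    numCycles := _
    cycLen := fun j => H.cycLen (e j)
    cyc := fun j => H.cyc (e j)
    cyc_pc := fun j => H.cyc_pc (e j)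
    cyc_long := fun j => H.cyc_long (e j)
    disj_path_cyc := fun j => hd _ (e j).2
    disj_cyc_cyc := fun _ _ hj => H.disj_cyc_cyc _ _
      fun h => hj (e.injective (Subtype.ext h)) }

theorem mem_verts {H : OnePathCycleT n c t} {v : V2 n} :
    v ∈ H.verts ↔ v ∈ H.path ∨ ∃ i, v ∈ Set.range (H.cyc i) := by
  simp [verts]

theorem mem_verts_withPathErase {H : OnePathCycleT n c t} {i : Fin H.numCycles}
    {l : List (V2 n)} {hl : IsPCPath n c l} {hd : ∀ i', i' ≠ i → ∀ j, H.cyc i' j ∉ l}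
    {v : V2 n} : v ∈ (H.withPathErase i l hl hd).verts ↔
      v ∈ l ∨ ∃ i', i' ≠ i ∧ v ∈ Set.range (H.cyc i') := by
  rw [mem_verts]
  refine or_congr Iff.rfl ⟨?_, ?_⟩
  · rintro ⟨j, hj⟩
    exact ⟨_, ((Fintype.equivFin {i' : Fin H.numCycles // i' ≠ i}).symm j).2, hj⟩
  · rintro ⟨i', hi', w, rfl⟩
    obtain ⟨j, hj⟩ := (Fintype.equivFin {i' : Fin H.numCycles // i' ≠ i}).symm.surjective
      ⟨i', hi'⟩
    refine ⟨j, ?_⟩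
    change H.cyc i' w ∈
      Set.range (H.cyc ((Fintype.equivFin {i' : Fin H.numCycles // i' ≠ i}).symm j).1)
    rw [hj]
    exact ⟨w, rfl⟩

/-- `H` has the most vertices and, subject to that, the longest path. -/
def IsOptimal (H : OnePathCycleT n c t) : Prop :=
  (∀ H' : OnePathCycleT n c t, H'.verts.ncard ≤ H.verts.ncard) ∧
    ∀ H' : OnePathCycleT n c t,
      H'.verts.ncard = H.verts.ncard → H'.path.length ≤ H.path.length

theorem IsOptimal.ne_of_cycle {H : OnePathCycleT n c t} (hH : H.IsOptimal) {a b : V2 n}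
    {r : List (V2 n)} (hp : H.path = a :: b :: r) {i : Fin H.numCycles}
    {f : ZMod (H.cycLen i) → V2 n} (hk : 2 ≤ H.cycLen i) (hf : IsPCCycle n c _ f)
    (hrange : Set.range f = Set.range (H.cyc i)) {j : ZMod (H.cycLen i)}
    (hadj : (KBB n).Adj (f j) a) (hb : c (f j) a ≠ c a b) :
    c (f (j - 1)) (f j) = c (f j) a := by
  by_contra hx
  obtain ⟨l, hl, hmem⟩ := hf.exists_path hk j
  rw [hrange] at hmem
  have hpc := H.path_pc
  rw [hp] at hpc
  have hnew := hl.append hpc (fun v hv => by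
    obtain ⟨w, rfl⟩ := (hmem v).1 hv
    rw [← hp]
    exact H.disj_path_cyc i w) hadj hx hb
  have hd : ∀ i', i' ≠ i → ∀ w, H.cyc i' w ∉ l ++ [f (j - 1), f j] ++ a :: b :: r := by
    intro i' hi' w hw
    rcases List.mem_append.1 hw with hw | hw
    · obtain ⟨w', hw'⟩ := (hmem _).1 hw
      exact H.disj_cyc_cyc _ _ hi'.symm _ _ hw'
    · rw [← hp] at hw
      exact H.disj_path_cyc _ _ hw
  have hverts : (H.withPathErase i _ hnew hd).verts = H.verts := by
    ext v
    rw [mem_verts_withPathErase, mem_verts, List.mem_append, hmem, ← hp]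
    constructor
    · rintro ((h | h) | ⟨i', -, h⟩)
      exacts [Or.inr ⟨i, h⟩, Or.inl h, Or.inr ⟨i', h⟩]
    · rintro (h | ⟨i', h⟩)
      · exact Or.inl (Or.inr h)
      · by_cases hi : i' = i
        · subst hi
          exact Or.inl (Or.inl h)
        · exact Or.inr ⟨i', hi, h⟩
  have := hH.2 _ (congrArg Set.ncard hverts)
  simp [withPathErase, hp] at this
  omega

theorem IsOptimal.mem_path {H : OnePathCycleT n c t} (hH : H.IsOptimal)
    (hsym : ∀ u v, c u v = c v u) (ht : 3 ≤ t) {a b : V2 n} {r : List (V2 n)}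
    (hp : H.path = a :: b :: r) {u : V2 n} (hadj : (KBB n).Adj a u) (hu : c a u ≠ c a b) :
    u ∈ H.path := by
  by_contra hmem
  rw [hsym a u] at hu
  by_cases hcyc : ∃ i, u ∈ Set.range (H.cyc i)
  · obtain ⟨i, j, rfl⟩ := hcyc
    have hk : 2 ≤ H.cycLen i := by have := H.cyc_long i; omega
    have h1 := hH.ne_of_cycle hp hk (H.cyc_pc i) rfl hadj.symm hu
    have h2 := hH.ne_of_cycle hp (f := fun x => H.cyc i (-x)) (j := -j) hk
      ((H.cyc_pc i).neg hsym) (neg_surjective.range_comp _) (by simpa using hadj.symm)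
      (by simpa using hu)
    have h3 := (H.cyc_pc i).2.2 (j - 1)
    rw [show j - 1 + 1 = j by ring, show j - 1 + 2 = j + 1 by ring] at h3
    simp only [neg_neg, show -(-j - 1) = j + 1 by ring] at h2
    rw [h1, ← h2, hsym] at h3
    exact h3 rfl
  · have hpc := H.path_pc
    rw [hp] at hpc
    have hnew := hpc.cons (hp ▸ hmem) hadj.symm hu
    have hd : ∀ i j, H.cyc i j ∉ u :: a :: b :: r := by
      intro i j h
      rcases List.mem_cons.1 h with h | h
      · exact hcyc ⟨i, j, h⟩
      · exact H.disj_path_cyc i j (hp ▸ h)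
    have hverts : (H.withPath _ hnew hd).verts = insert u H.verts := by
      ext v
      rw [Set.mem_insert_iff, mem_verts, mem_verts, hp, ← or_assoc]
      exact or_congr List.mem_cons Iff.rfl
    have hnot : u ∉ H.verts := fun h => (mem_verts.1 h).elim hmem hcyc
    have := hH.1 (H.withPath _ hnew hd)
    rw [hverts, Set.ncard_insert_of_notMem hnot (Set.toFinite _)] at this
    omega

theorem IsOptimal.reverse {H : OnePathCycleT n c t} (hH : H.IsOptimal)
    (hsym : ∀ u v, c u v = c v u) :
    (H.withPath _ (H.path_pc.reverse hsym)
      (fun i j => by simpa using H.disj_path_cyc i j)).IsOptimal := by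
  have hverts : (H.withPath _ (H.path_pc.reverse hsym)
      (fun i j => by simpa using H.disj_path_cyc i j)).verts = H.verts := by
    ext v
    rw [mem_verts, mem_verts]
    exact or_congr List.mem_reverse Iff.rfl
  unfold IsOptimal
  rw [hverts]
  refine ⟨hH.1, fun H' h => (hH.2 H' h).trans_eq ?_⟩
  exact List.length_reverse.symm

end OnePathCycleT

theorem colorDeg_le_card {a : V2 n} {S : Finset (V2 n)}
    (h : ∀ u, (KBB n).Adj a u → ∃ w ∈ S, c a w = c a u) : colorDeg n c a ≤ S.card := by
  refine le_trans ?_ (Finset.card_image_le (s := S) (f := c a))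
  cases a <;>
  · refine Finset.card_le_card fun k hk => ?_
    obtain ⟨j, -, rfl⟩ := Finset.mem_image.1 hk
    exact Finset.mem_image.2 (h _ (by simp [KBB]))

theorem two_mul_countP_le_of_isChain (l : List (V2 n)) (a : V2 n)
    (h : (a :: l).IsChain (KBB n).Adj) :
    2 * (a :: l).countP (fun v => v.isLeft = !a.isLeft) ≤ l.length + 1 ∧
      2 * (a :: l).countP (fun v => v.isLeft = a.isLeft) ≤ l.length + 2 := by
  induction l generalizing a with
  | nil => cases a <;> simp
  | cons b l ih =>
    obtain ⟨hab, hl⟩ := List.isChain_cons_cons.1 h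
    obtain ⟨h1, h2⟩ := ih b hl
    rw [KBB_adj_iff] at hab
    simp only [hab, Bool.not_not] at h1 h2
    rw [List.countP_cons, List.countP_cons (a := a)]
    cases a <;> simp at h1 h2 ⊢ <;> omega

theorem minColorDeg_le (v : V2 n) : minColorDeg n c ≤ colorDeg n c v :=
  ciInf_le (OrderBot.bddBelow _) v

end

/-- claim (1) of the proof of Theorem 1.4.  With `H` and `P = u₁…u_k`
(`k ≥ 2`) chosen as in Lemma 2.1, every neighbor `u` of `u₁` with
`c(u₁u) ≠ c(u₁u₂)` lies in `V(P)`, every neighbor `u` of `u_k` with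
`c(u_ku) ≠ c(u_{k-1}u_k)` lies in `V(P)`, and consequently `k ≥ 2δ^c(G)`. -/
theorem endpoints_color_neighbors_in_path (n t : ℕ) (ht : 3 ≤ t)
    (c : V2 n → V2 n → ℕ) (hsym : ∀ u v, c u v = c v u)
    (hdeg : ∀ v, (2 * n : ℝ) / 3 + t ≤ (colorDeg n c v : ℝ))
    (hno : ¬∃ F : SimpleGraph (V2 n), IsPC2Factor n c F ∧ CyclesAtLeast F t)
    (H : OnePathCycleT n c t)
    (hmaxH : ∀ H' : OnePathCycleT n c t, H'.verts.ncard ≤ H.verts.ncard)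
    (hmaxP : ∀ H' : OnePathCycleT n c t,
      H'.verts.ncard = H.verts.ncard → H'.path.length ≤ H.path.length)
    (hk : 2 ≤ H.path.length) :
    (∀ u : V2 n, (KBB n).Adj (H.path[0]'(by omega)) u →
      c (H.path[0]'(by omega)) u ≠ c (H.path[0]'(by omega)) (H.path[1]'(by omega)) →
      u ∈ H.path) ∧
    (∀ u : V2 n, (KBB n).Adj (H.path[H.path.length - 1]'(by omega)) u →
      c (H.path[H.path.length - 1]'(by omega)) u ≠
        c (H.path[H.path.length - 2]'(by omega)) (H.path[H.path.length - 1]'(by omega)) →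
      u ∈ H.path) ∧
    2 * minColorDeg n c ≤ H.path.length := by
  have hH : H.IsOptimal := ⟨hmaxH, hmaxP⟩
  obtain ⟨a, b, r, hp⟩ : ∃ a b r, H.path = a :: b :: r := by
    match hl : H.path with
    | [] => simp [hl] at hk
    | [a] => simp [hl] at hk
    | a :: b :: r => exact ⟨a, b, r, rfl⟩
  have hfirst : ∀ u, (KBB n).Adj a u → c a u ≠ c a b → u ∈ H.path :=
    fun u => hH.mem_path hsym ht hp
  refine ⟨?_, ?_, ?_⟩
  · simpa [hp] using hfirst
  · intro u hadj hu
    have hlen : H.path.reverse.length = H.path.length := List.length_reverse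
    obtain ⟨x, y, s, hr⟩ : ∃ x y s, H.path.reverse = x :: y :: s := by
      match hl : H.path.reverse with
      | [] => simp [hl] at hlen; omega
      | [x] => simp [hl] at hlen; omega
      | x :: y :: s => exact ⟨x, y, s, rfl⟩
    have hx : H.path[H.path.length - 1] = x := by
      have : H.path.reverse[0]'(by omega) = x := by simp [hr]
      simpa [List.getElem_reverse] using this
    have hy : H.path[H.path.length - 2] = y := by
      have : H.path.reverse[1]'(by omega) = y := by simp [hr]
      simpa [List.getElem_reverse, Nat.sub_sub] using this
    rw [hx] at hadj hu
    rw [hy, hsym y x] at hu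
    exact List.mem_reverse.1 ((hH.reverse hsym).mem_path hsym ht hr hadj hu)
  · have hchain : (a :: b :: r).IsChain (KBB n).Adj := hp ▸ H.path_pc.2.2.1
    have hab : (KBB n).Adj a b := (List.isChain_cons_cons.1 hchain).1
    have hcount := (two_mul_countP_le_of_isChain _ _ hchain).1
    rw [← List.length_cons, ← hp, List.countP_eq_length_filter] at hcount
    have hdeg_le : colorDeg n c a ≤
        (H.path.filter fun v => v.isLeft = !a.isLeft).toFinset.card := by
      refine colorDeg_le_card fun u hu => ?_
      by_cases hc : c a u = c a b
      · refine ⟨b, ?_, hc.symm⟩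
        simp [hp, KBB_adj_iff.1 hab]
      · refine ⟨u, ?_, rfl⟩
        simp [hfirst u hu hc, KBB_adj_iff.1 hu]
    have := minColorDeg_le (c := c) a
    have := List.toFinset_card_le (H.path.filter fun v => v.isLeft = !a.isLeft)
    omega
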